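/- Assume q_0 has finite fourth moment. Then for every t > 0 and every x ∈ ℝ^d, ∂_t ∇_x³ log q_t(x) = − (3(λ_t³ + λ_t⁵)/σ_t⁸) E_{t,x}[ (θ − m(t, x))^{⊗3} ] − (λ_t³/(2σ_t⁶)) Σ_{π ∈ perm(3)} M_π + (λ_t³/σ_t⁶) E_{t,x}[ (θ − m(t, x))^{⊗3} ( f_0(θ, x, t) − E_{t,x}[f_0(θ, x, t)] ) ], where for each permutation π of {1,2,3} the tensor M_π ∈ ℝ^{d×d×d} has entries (M_π)_{i₁ i₂ i₃} = E_{t,x}[ (θ − m(t,x))_{i_{π(1)}} (θ − m(t,x))_{i_{π(2)}} ] · E_{t,x}[ (θ − m(t,x))_{i_{π(3)}} ( f_0(θ, x, t) − E_{t,x}[f_0(θ, x, t)] ) ], and f_0(θ, x, t) = (λ_t²/σ_t⁴) ‖θ‖₂² − ((λ_t + λ_t³)/σ_t⁴) ⟨x, θ⟩. -/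

import Mathlib

open MeasureTheory ProbabilityTheory Real
open scoped RealInnerProductSpace

noncomputable section

abbrev Vec (d : ℕ) := EuclideanSpace ℝ (Fin d)

def stdGaussian (d : ℕ) : Measure (Vec d) :=
  Measure.map (⇑(EuclideanSpace.equiv (Fin d) ℝ).symm)
    (Measure.pi fun _ : Fin d => gaussianReal 0 1)

/-- The law `q_u` of `e^{-u} θ + √(1 - e^{-2u}) g`, with `θ ~ q0` and `g ~ N(0, I_d)`
independent. -/
def forwardLaw {d : ℕ} (q0 : Measure (Vec d)) (u : ℝ) : Measure (Vec d) :=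
  Measure.map (fun p : Vec d × Vec d =>
      Real.exp (-u) • p.1 + Real.sqrt (1 - Real.exp (-2*u)) • p.2)
    (q0.prod (stdGaussian d))

/-- Gaussian weight `exp(-‖x - λ_t θ‖² / (2σ_t²))`. -/
def weight {d : ℕ} (t : ℝ) (x θ : Vec d) : ℝ :=
  Real.exp (-‖x - Real.exp (-t) • θ‖^2 / (2 * (1 - Real.exp (-2*t))))

/-- The conditional law `μ_{t,x}` of `θ` given `λ_t θ + σ_t g = x`:
`dμ_{t,x}(θ) = Z_{t,x}⁻¹ exp(-‖x - λ_t θ‖²/(2σ_t²)) dq0(θ)`. -/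
def condMeasure {d : ℕ} (q0 : Measure (Vec d)) (t : ℝ) (x : Vec d) : Measure (Vec d) :=
  (∫⁻ θ, ENNReal.ofReal (weight t x θ) ∂q0)⁻¹ •
    q0.withDensity fun θ => ENNReal.ofReal (weight t x θ)

/-- The conditional mean `m(t, x) = E_{t,x}[θ]`. -/
def condMean {d : ℕ} (q0 : Measure (Vec d)) (t : ℝ) (x : Vec d) : Vec d :=
  ∫ θ, θ ∂(condMeasure q0 t x)

/-- Partial derivative in the `i`-th coordinate direction. -/
def pd {d : ℕ} (i : Fin d) (f : Vec d → ℝ) (x : Vec d) : ℝ :=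
  fderiv ℝ f x (EuclideanSpace.single i 1)

/-- The auxiliary function `f₀(θ, x, t) = (λ_t²/σ_t⁴)‖θ‖² - ((λ_t + λ_t³)/σ_t⁴)⟨x, θ⟩`. -/
def f0 {d : ℕ} (t : ℝ) (x θ : Vec d) : ℝ :=
  Real.exp (-t)^2 / (1 - Real.exp (-2*t))^2 * ‖θ‖^2
    - (Real.exp (-t) + Real.exp (-t)^3) / (1 - Real.exp (-2*t))^2 * @inner ℝ _ _ x θ

/-- The standard Gaussian measure has a density proportional to `exp (-‖x‖² / 2)`. -/
lemma exists_stdGaussian_eq_withDensity (d : ℕ) : ∃ c : ℝ, 0 < c ∧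
    _root_.stdGaussian d =
      volume.withDensity fun x : Vec d => ENNReal.ofReal (c * rexp (-‖x‖ ^ 2 / 2)) := by
  have hhalf : 0 < ((1 / 2 : ℂ)).re := by norm_num
  have hval : ∫ v : Vec d, rexp (-(1 / 2) * ‖v‖ ^ 2)
      = (π / (1 / 2)) ^ (Module.finrank ℝ (Vec d) / 2 : ℝ) :=
    GaussianFourier.integral_rexp_neg_mul_sq_norm (by norm_num)
  have hpos : 0 < ∫ v : Vec d, rexp (-(1 / 2) * ‖v‖ ^ 2) := by
    rw [hval]; positivity
  have hintegrable : Integrable fun v : Vec d => rexp (-‖v‖ ^ 2 / 2) :=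
    (Integrable.of_integral_ne_zero hpos.ne').congr (ae_of_all _ fun v => by
      simp only; congr 1; ring)
  refine ⟨(∫ v : Vec d, rexp (-(1 / 2) * ‖v‖ ^ 2))⁻¹, inv_pos.2 hpos, ?_⟩
  set c := (∫ v : Vec d, rexp (-(1 / 2) * ‖v‖ ^ 2))⁻¹ with hc
  have hc0 : 0 < c := inv_pos.2 hpos
  have hstd : _root_.stdGaussian d = ProbabilityTheory.stdGaussian (Vec d) := by
    rw [← map_pi_eq_stdGaussian]; rfl
  have : IsFiniteMeasure
      (volume.withDensity fun x : Vec d => ENNReal.ofReal (c * rexp (-‖x‖ ^ 2 / 2))) :=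
    isFiniteMeasure_withDensity_ofReal (hintegrable.const_mul c).2
  rw [hstd]
  refine Measure.ext_of_charFun (funext fun w => ?_)
  rw [charFun_stdGaussian, charFun_apply, integral_withDensity_eq_integral_toReal_smul
    (by fun_prop) (ae_of_all _ fun _ => ENNReal.ofReal_lt_top)]
  have hfourier := GaussianFourier.integral_cexp_neg_mul_sq_norm_add hhalf Complex.I w
  have hnorm := GaussianFourier.integral_cexp_neg_mul_sq_norm (V := Vec d) hhalf
  have hcast : ∫ v : Vec d, Complex.exp (-(1 / 2) * ‖v‖ ^ 2) = ((c⁻¹ : ℝ) : ℂ) := by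
    rw [hc, inv_inv, ← integral_complex_ofReal]
    congr 1 with v
    push_cast
    rfl
  rw [← hnorm, hcast] at hfourier
  have hrw : ∀ v : Vec d, (ENNReal.ofReal (c * rexp (-‖v‖ ^ 2 / 2))).toReal
        • Complex.exp (⟪v, w⟫ * Complex.I)
      = (c : ℂ) * Complex.exp (-(1 / 2) * ‖v‖ ^ 2 + Complex.I * ⟪w, v⟫) := fun v => by
    rw [ENNReal.toReal_ofReal (by positivity), Complex.real_smul, Complex.ofReal_mul, mul_assoc,
      Complex.ofReal_exp, ← Complex.exp_add, real_inner_comm]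
    congr 2
    push_cast
    ring
  simp_rw [hrw]
  rw [integral_const_mul, hfourier, ← mul_assoc, ← Complex.ofReal_mul, mul_inv_cancel₀ hc0.ne',
    Complex.ofReal_one, one_mul, Complex.I_sq]
  congr 1
  ring

lemma weight_pos {d : ℕ} (t : ℝ) (x θ : Vec d) : 0 < weight t x θ := exp_pos _

lemma variance_pos {t : ℝ} (ht : 0 < t) : 0 < 1 - rexp (-2 * t) := by
  have : rexp (-2 * t) < 1 := by simpa using ht
  linarith

lemma lintegral_comp_add_smul {d : ℕ} (h : Vec d → ENNReal) (hh : Measurable h) (v : Vec d) {s : ℝ}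
    (hs : s ≠ 0) :
    ∫⁻ g, h (v + s • g) = ENNReal.ofReal |(s ^ d)⁻¹| * ∫⁻ y, h y := by
  have hmap := lintegral_map (μ := (volume : Measure (Vec d))) (f := fun y => h (v + y))
    (g := fun y => s • y) (by fun_prop) (by fun_prop)
  rw [← hmap, Measure.map_addHaar_smul _ hs, lintegral_smul_measure,
    lintegral_add_left_eq_self h v]
  simp

lemma exists_forwardLaw_eq_withDensity {d : ℕ} (q0 : Measure (Vec d)) [IsProbabilityMeasure q0]
    {u : ℝ} (hu : 0 < u) : ∃ c : ℝ, 0 < c ∧ forwardLaw q0 u =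
      volume.withDensity fun x => ∫⁻ θ, ENNReal.ofReal (c * weight u x θ) ∂q0 := by
  obtain ⟨c, hc, hstd⟩ := exists_stdGaussian_eq_withDensity d
  have hv := variance_pos hu
  set s := √(1 - rexp (-2 * u)) with hs
  have hs0 : 0 < s := Real.sqrt_pos.2 hv
  have hs2 : s ^ 2 = 1 - rexp (-2 * u) := Real.sq_sqrt hv.le
  have hwm : Measurable fun p : Vec d × Vec d => weight u p.1 p.2 := by
    unfold weight; fun_prop
  have hcs : 0 < |(s ^ d)⁻¹| * c := by positivity
  refine ⟨|(s ^ d)⁻¹| * c, hcs, Measure.ext_of_lintegral _ fun f hf => ?_⟩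
  have hprob : IsProbabilityMeasure (_root_.stdGaussian d) :=
    Measure.isProbabilityMeasure_map (by fun_prop)
  rw [forwardLaw, lintegral_map hf (by fun_prop), lintegral_prod _ (by fun_prop),
    lintegral_withDensity_eq_lintegral_mul _ (by fun_prop) hf]
  have hinner : ∀ θ : Vec d,
      ∫⁻ g, f (rexp (-u) • θ + s • g) ∂(_root_.stdGaussian d)
        = ∫⁻ x, ENNReal.ofReal (|(s ^ d)⁻¹| * c * weight u x θ) * f x := fun θ => by
    rw [hstd, lintegral_withDensity_eq_lintegral_mul _ (by fun_prop) (by fun_prop)]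
    have hfun : ∀ g : Vec d, ((fun x : Vec d => ENNReal.ofReal (c * rexp (-‖x‖ ^ 2 / 2)))
          * fun g => f (rexp (-u) • θ + s • g)) g
        = (fun x => ENNReal.ofReal (c * weight u x θ) * f x) (rexp (-u) • θ + s • g) := fun g => by
      simp only [Pi.mul_apply, weight, add_sub_cancel_left, norm_smul, mul_pow, hs2.symm,
        Real.norm_of_nonneg hs0.le]
      congr 4
      field_simp
    simp_rw [hfun]
    rw [lintegral_comp_add_smul (fun x => ENNReal.ofReal (c * weight u x θ) * f x) (by fun_prop) _
      hs0.ne', ← lintegral_const_mul _ (by fun_prop)]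
    congr 1 with x
    rw [← mul_assoc, ← ENNReal.ofReal_mul (abs_nonneg _), mul_assoc]
  simp only [← hs, hinner]
  rw [lintegral_lintegral_swap (by fun_prop)]
  congr 1 with x
  rw [Pi.mul_apply, lintegral_mul_const _ (by fun_prop)]

/-- Continuous functions of at most exponential growth. -/
def ExpGrowth {d : ℕ} (φ : Vec d → ℝ) : Prop :=
  Continuous φ ∧ ∃ C K : ℝ, 0 ≤ C ∧ 0 ≤ K ∧ ∀ θ, |φ θ| ≤ C * rexp (K * ‖θ‖)

namespace ExpGrowth

variable {d : ℕ} {φ ψ : Vec d → ℝ}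

lemma const (c : ℝ) : ExpGrowth fun _ : Vec d => c :=
  ⟨continuous_const, |c|, 0, abs_nonneg c, le_rfl, fun θ => by simp⟩

lemma mul (hφ : ExpGrowth φ) (hψ : ExpGrowth ψ) : ExpGrowth fun θ => φ θ * ψ θ := by
  obtain ⟨hc, C, K, hC, hK, h⟩ := hφ
  obtain ⟨hc', C', K', hC', hK', h'⟩ := hψ
  refine ⟨hc.mul hc', C * C', K + K', by positivity, by positivity, fun θ => ?_⟩
  calc |φ θ * ψ θ| = |φ θ| * |ψ θ| := abs_mul _ _
    _ ≤ (C * rexp (K * ‖θ‖)) * (C' * rexp (K' * ‖θ‖)) :=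
      mul_le_mul (h θ) (h' θ) (abs_nonneg _) (by positivity)
    _ = _ := by rw [add_mul, exp_add]; ring

lemma sub (hφ : ExpGrowth φ) (hψ : ExpGrowth ψ) : ExpGrowth fun θ => φ θ - ψ θ := by
  obtain ⟨hc, C, K, hC, hK, h⟩ := hφ
  obtain ⟨hc', C', K', hC', hK', h'⟩ := hψ
  refine ⟨hc.sub hc', C + C', K + K', by positivity, by positivity, fun θ => ?_⟩
  have h1 : rexp (K * ‖θ‖) ≤ rexp ((K + K') * ‖θ‖) := by gcongr; linarith
  have h2 : rexp (K' * ‖θ‖) ≤ rexp ((K + K') * ‖θ‖) := by gcongr; linarith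
  calc |φ θ - ψ θ| ≤ |φ θ| + |ψ θ| := abs_sub _ _
    _ ≤ C * rexp (K * ‖θ‖) + C' * rexp (K' * ‖θ‖) := add_le_add (h θ) (h' θ)
    _ ≤ C * rexp ((K + K') * ‖θ‖) + C' * rexp ((K + K') * ‖θ‖) := by gcongr
    _ = _ := by ring

lemma norm : ExpGrowth fun θ : Vec d => ‖θ‖ :=
  ⟨continuous_norm, 1, 1, zero_le_one, zero_le_one, fun θ => by
    rw [abs_norm, one_mul, one_mul]
    linarith [add_one_le_exp ‖θ‖]⟩

lemma inner (z : Vec d) : ExpGrowth fun θ : Vec d => ⟪z, θ⟫ := by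
  refine ⟨by fun_prop, ‖z‖, 1, norm_nonneg z, zero_le_one, fun θ => ?_⟩
  refine (abs_real_inner_le_norm z θ).trans ?_
  gcongr
  rw [one_mul]
  linarith [add_one_le_exp ‖θ‖]

lemma coord (i : Fin d) : ExpGrowth fun θ : Vec d => θ i := by
  simpa [EuclideanSpace.inner_single_left] using inner (EuclideanSpace.single i (1 : ℝ))

lemma exponent (z : Vec d) (b : ℝ) : ExpGrowth fun θ : Vec d => ⟪z, θ⟫ - b * ‖θ‖ ^ 2 := by
  simpa only [pow_two] using (inner z).sub ((const b).mul (norm.mul norm))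

end ExpGrowth

/-- The unnormalized tilted integral `∫ φ(θ) exp(⟪z, θ⟫ - b‖θ‖²) dq₀(θ)`. -/
def tiltInt {d : ℕ} (q0 : Measure (Vec d)) (φ : Vec d → ℝ) (z : Vec d) (b : ℝ) : ℝ :=
  ∫ θ, φ θ * rexp (⟪z, θ⟫ - b * ‖θ‖ ^ 2) ∂q0

/-- The normalized tilted expectation. -/
def tiltMean {d : ℕ} (q0 : Measure (Vec d)) (φ : Vec d → ℝ) (z : Vec d) (b : ℝ) : ℝ :=
  tiltInt q0 φ z b / tiltInt q0 (fun _ => 1) z b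

section Tilt

variable {d : ℕ} {q0 : Measure (Vec d)} [IsProbabilityMeasure q0] {φ : Vec d → ℝ}

lemma ExpGrowth.exists_bound (hφ : ExpGrowth φ) (R : ℝ) {ε : ℝ} (hε : 0 < ε) :
    ∃ B, ∀ θ z b, ‖z‖ ≤ R → ε ≤ b → |φ θ * rexp (⟪z, θ⟫ - b * ‖θ‖ ^ 2)| ≤ B := by
  obtain ⟨-, C, K, hC, hK, h⟩ := hφ
  refine ⟨C * rexp ((K + R) ^ 2 / (4 * ε)), fun θ z b hz hb => ?_⟩
  rw [abs_mul, abs_of_pos (exp_pos _)]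
  calc |φ θ| * rexp (⟪z, θ⟫ - b * ‖θ‖ ^ 2)
      ≤ (C * rexp (K * ‖θ‖)) * rexp (R * ‖θ‖ - ε * ‖θ‖ ^ 2) := by
        gcongr
        · exact h θ
        · exact (real_inner_le_norm z θ).trans (by gcongr)
    _ = C * rexp ((K + R) * ‖θ‖ - ε * ‖θ‖ ^ 2) := by
        rw [mul_assoc, ← exp_add]; ring_nf
    _ ≤ C * rexp ((K + R) ^ 2 / (4 * ε)) := by
        gcongr
        rw [le_div_iff₀ (by positivity)]
        nlinarith [sq_nonneg (K + R - 2 * ε * ‖θ‖)]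

lemma ExpGrowth.integrable_tilt (hφ : ExpGrowth φ) (z : Vec d) {b : ℝ} (hb : 0 < b) :
    Integrable (fun θ => φ θ * rexp (⟪z, θ⟫ - b * ‖θ‖ ^ 2)) q0 := by
  obtain ⟨B, hB⟩ := hφ.exists_bound ‖z‖ hb
  have hc := hφ.1
  exact Integrable.of_bound (by fun_prop) B
    (ae_of_all _ fun θ => by simpa using hB θ z b le_rfl le_rfl)

lemma tiltInt_one_pos (z : Vec d) {b : ℝ} (hb : 0 < b) : 0 < tiltInt q0 (fun _ => 1) z b := by
  have hi := (ExpGrowth.const (d := d) 1).integrable_tilt (q0 := q0) z hb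
  refine (integral_pos_iff_support_of_nonneg (fun θ => by positivity) hi).2 ?_
  have : Function.support (fun θ : Vec d => 1 * rexp (⟪z, θ⟫ - b * ‖θ‖ ^ 2)) = Set.univ := by
    ext θ; simp [exp_ne_zero]
  rw [this]; simp

/-- The Fréchet derivative of the tilted integrand in `(z, b)`. -/
def tiltFDeriv (φ : Vec d → ℝ) (p : Vec d × ℝ) (θ : Vec d) : Vec d × ℝ →L[ℝ] ℝ :=
  (φ θ * rexp (⟪p.1, θ⟫ - p.2 * ‖θ‖ ^ 2)) •
    ((innerSL ℝ θ).comp (ContinuousLinearMap.fst ℝ (Vec d) ℝ)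
      - ‖θ‖ ^ 2 • ContinuousLinearMap.snd ℝ (Vec d) ℝ)

lemma tiltFDeriv_apply (p v : Vec d × ℝ) (θ : Vec d) :
    tiltFDeriv φ p θ v
      = φ θ * (⟪v.1, θ⟫ - v.2 * ‖θ‖ ^ 2) * rexp (⟪p.1, θ⟫ - p.2 * ‖θ‖ ^ 2) := by
  simp only [tiltFDeriv, _root_.smul_apply, _root_.sub_apply,
    ContinuousLinearMap.comp_apply, ContinuousLinearMap.coe_fst', ContinuousLinearMap.coe_snd',
    innerSL_apply_apply, smul_eq_mul, real_inner_comm]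
  ring

lemma norm_tiltFDeriv_le (p : Vec d × ℝ) (θ : Vec d) :
    ‖tiltFDeriv φ p θ‖
      ≤ |φ θ * (‖θ‖ - (-1) * (‖θ‖ * ‖θ‖)) * rexp (⟪p.1, θ⟫ - p.2 * ‖θ‖ ^ 2)| := by
  have hn : 0 ≤ ‖θ‖ - (-1) * (‖θ‖ * ‖θ‖) := by nlinarith [norm_nonneg θ]
  rw [mul_right_comm, abs_mul, abs_of_nonneg hn, tiltFDeriv, norm_smul, Real.norm_eq_abs]
  gcongr
  refine ContinuousLinearMap.opNorm_le_bound _ hn fun v => ?_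
  have h1 : |⟪θ, v.1⟫| ≤ ‖θ‖ * ‖v‖ :=
    (abs_real_inner_le_norm θ v.1).trans (by gcongr; exact norm_fst_le v)
  have h2 : |‖θ‖ ^ 2 * v.2| ≤ ‖θ‖ ^ 2 * ‖v‖ := by
    rw [abs_mul, abs_of_nonneg (by positivity)]
    gcongr
    exact norm_snd_le v
  simp only [_root_.smul_apply, _root_.sub_apply,
    ContinuousLinearMap.comp_apply, ContinuousLinearMap.coe_fst', ContinuousLinearMap.coe_snd',
    innerSL_apply_apply, smul_eq_mul, Real.norm_eq_abs]
  refine (abs_sub _ _).trans ((add_le_add h1 h2).trans_eq ?_)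
  ring

lemma continuous_tiltFDeriv (hφ : Continuous φ) (p : Vec d × ℝ) :
    Continuous (tiltFDeriv φ p) := by
  unfold tiltFDeriv
  fun_prop

lemma hasFDerivAt_tilt_integrand (p : Vec d × ℝ) (θ : Vec d) :
    HasFDerivAt (fun p : Vec d × ℝ => φ θ * rexp (⟪p.1, θ⟫ - p.2 * ‖θ‖ ^ 2))
      (tiltFDeriv φ p θ) p := by
  have hlin : HasFDerivAt (fun p : Vec d × ℝ => ⟪p.1, θ⟫ - p.2 * ‖θ‖ ^ 2)
      ((innerSL ℝ θ).comp (ContinuousLinearMap.fst ℝ (Vec d) ℝ)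
      - ‖θ‖ ^ 2 • ContinuousLinearMap.snd ℝ (Vec d) ℝ) p := by
    refine (ContinuousLinearMap.hasFDerivAt _).congr_of_eventuallyEq
      (Filter.Eventually.of_forall fun v => ?_)
    simp [real_inner_comm, mul_comm]
  convert! (hlin.exp.const_mul (φ θ)) using 1
  rw [tiltFDeriv, smul_smul]

lemma hasFDerivAt_tiltInt (hφ : ExpGrowth φ) {p : Vec d × ℝ} (hp : 0 < p.2) :
    Integrable (tiltFDeriv φ p) q0 ∧ HasFDerivAt (fun p : Vec d × ℝ => tiltInt q0 φ p.1 p.2)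
      (∫ θ, tiltFDeriv φ p θ ∂q0) p := by
  have hψ : ExpGrowth fun θ => φ θ * (‖θ‖ - (-1) * (‖θ‖ * ‖θ‖)) :=
    hφ.mul (ExpGrowth.norm.sub ((ExpGrowth.const (-1)).mul (ExpGrowth.norm.mul ExpGrowth.norm)))
  obtain ⟨B, hB⟩ := hψ.exists_bound (‖p.1‖ + p.2 / 2) (half_pos hp)
  have hc := hφ.1
  have hbound : ∀ᵐ θ ∂q0, ∀ v ∈ Metric.ball p (p.2 / 2), ‖tiltFDeriv φ v θ‖ ≤ B := by
    refine ae_of_all _ fun θ v hv => (norm_tiltFDeriv_le v θ).trans (hB θ v.1 v.2 ?_ ?_)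
    · have h1 : ‖v.1 - p.1‖ ≤ ‖v - p‖ := norm_fst_le (v - p)
      have h2 : ‖v.1‖ ≤ ‖p.1‖ + ‖v.1 - p.1‖ := norm_le_norm_add_norm_sub' _ _
      rw [Metric.mem_ball, dist_eq_norm] at hv
      linarith
    · have h1 : ‖v.2 - p.2‖ ≤ ‖v - p‖ := norm_snd_le (v - p)
      rw [Metric.mem_ball, dist_eq_norm] at hv
      have h2 := neg_abs_le (v.2 - p.2)
      rw [Real.norm_eq_abs] at h1
      linarith
  have hmeas := (continuous_tiltFDeriv hc p).aestronglyMeasurable (μ := q0)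
  refine ⟨Integrable.of_bound hmeas B ?_,
    hasFDerivAt_integral_of_dominated_of_fderiv_le (Metric.ball_mem_nhds p (half_pos hp))
    (Filter.Eventually.of_forall fun v => by fun_prop) (hφ.integrable_tilt p.1 hp)
    hmeas hbound (integrable_const B)
    (ae_of_all _ fun θ v _ => hasFDerivAt_tilt_integrand v θ)⟩
  filter_upwards [hbound] with θ hθ using hθ p (Metric.mem_ball_self (half_pos hp))

lemma hasDerivAt_tiltInt (hφ : ExpGrowth φ) {z : ℝ → Vec d} {b : ℝ → ℝ} {z' : Vec d} {b' s : ℝ}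
    (hz : HasDerivAt z z' s) (hb : HasDerivAt b b' s) (hpos : 0 < b s) :
    HasDerivAt (fun r => tiltInt q0 φ (z r) (b r))
      (tiltInt q0 (fun θ => φ θ * (⟪z', θ⟫ - b' * ‖θ‖ ^ 2)) (z s) (b s)) s := by
  obtain ⟨hi, hd⟩ := hasFDerivAt_tiltInt (q0 := q0) hφ (p := (z s, b s)) hpos
  have h := hd.comp_hasDerivAt s (hz.prodMk hb)
  rw [ContinuousLinearMap.integral_apply hi] at h
  simp only [tiltFDeriv_apply] at h
  exact h

/-- Differentiating a tilted mean produces a covariance with the derivative of the exponent. -/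
lemma hasDerivAt_tiltMean (hφ : ExpGrowth φ) {z : ℝ → Vec d} {b : ℝ → ℝ} {z' : Vec d} {b' s : ℝ}
    (hz : HasDerivAt z z' s) (hb : HasDerivAt b b' s) (hpos : 0 < b s) :
    HasDerivAt (fun r => tiltMean q0 φ (z r) (b r))
      (tiltMean q0 (fun θ => φ θ * (⟪z', θ⟫ - b' * ‖θ‖ ^ 2)) (z s) (b s)
        - tiltMean q0 φ (z s) (b s)
          * tiltMean q0 (fun θ => ⟪z', θ⟫ - b' * ‖θ‖ ^ 2) (z s) (b s)) s := by
  have h1 := hasDerivAt_tiltInt (q0 := q0) hφ hz hb hpos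
  have h2 := hasDerivAt_tiltInt (q0 := q0) (ExpGrowth.const 1) hz hb hpos
  have hne := (tiltInt_one_pos (q0 := q0) (z s) hpos).ne'
  convert! h1.div h2 hne using 1
  simp only [tiltMean, one_mul]
  field_simp

end Tilt

section Bridge

/-- The linear coefficient `λ_t / σ_t²` of the exponent of the Gaussian weight. -/
def linCoeff (t : ℝ) : ℝ := rexp (-t) / (1 - rexp (-2 * t))

/-- The quadratic coefficient `λ_t² / (2σ_t²)` of the exponent of the Gaussian weight. -/
def quadCoeff (t : ℝ) : ℝ := rexp (-t) ^ 2 / (2 * (1 - rexp (-2 * t)))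

lemma quadCoeff_pos {t : ℝ} (ht : 0 < t) : 0 < quadCoeff t := by
  have := variance_pos ht
  unfold quadCoeff
  positivity

lemma hasDerivAt_variance (t : ℝ) :
    HasDerivAt (fun u => 1 - rexp (-2 * u)) (2 * rexp (-t) ^ 2) t := by
  have h : HasDerivAt (fun u : ℝ => -2 * u) (-2) t := by
    simpa using (hasDerivAt_id t).const_mul (-2 : ℝ)
  convert! h.exp.const_sub 1 using 1
  rw [← exp_nat_mul]
  push_cast
  rw [mul_neg, neg_mul, mul_comm _ (-2 : ℝ)]
  ring

lemma hasDerivAt_exp_neg (t : ℝ) : HasDerivAt (fun u => rexp (-u)) (-rexp (-t)) t := by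
  simpa using (hasDerivAt_neg t).exp

lemma exp_neg_two_mul (t : ℝ) : rexp (-2 * t) = rexp (-t) ^ 2 := by
  rw [← exp_nat_mul]
  push_cast
  ring_nf

lemma hasDerivAt_linCoeff {t : ℝ} (ht : 0 < t) :
    HasDerivAt linCoeff (-((rexp (-t) + rexp (-t) ^ 3) / (1 - rexp (-2 * t)) ^ 2)) t := by
  have hv := (variance_pos ht).ne'
  convert! (hasDerivAt_exp_neg t).div (hasDerivAt_variance t) hv using 1
  rw [exp_neg_two_mul] at *
  field_simp
  ring

lemma hasDerivAt_quadCoeff {t : ℝ} (ht : 0 < t) :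
    HasDerivAt quadCoeff (-(rexp (-t) ^ 2 / (1 - rexp (-2 * t)) ^ 2)) t := by
  have hv := (variance_pos ht).ne'
  convert! ((hasDerivAt_exp_neg t).pow 2).div ((hasDerivAt_variance t).const_mul 2)
    (mul_ne_zero two_ne_zero hv) using 1
  rw [exp_neg_two_mul] at *
  simp only [Pi.pow_apply]
  field_simp
  push_cast
  ring

variable {d : ℕ} {q0 : Measure (Vec d)}

lemma weight_eq {t : ℝ} (ht : 0 < t) (x θ : Vec d) :
    weight t x θ = rexp (-‖x‖ ^ 2 / (2 * (1 - rexp (-2 * t))))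
      * rexp (⟪linCoeff t • x, θ⟫ - quadCoeff t * ‖θ‖ ^ 2) := by
  have hv := (variance_pos ht).ne'
  rw [weight, ← exp_add, norm_sub_sq_real, norm_smul, real_inner_smul_left, real_inner_smul_right,
    Real.norm_of_nonneg (exp_pos _).le, linCoeff, quadCoeff]
  congr 1
  field_simp
  ring

lemma measurable_weight (t : ℝ) (x : Vec d) : Measurable (weight t x) := by
  unfold weight
  fun_prop

lemma integral_mul_weight {t : ℝ} (ht : 0 < t) (x : Vec d) (φ : Vec d → ℝ) :
    ∫ θ, weight t x θ * φ θ ∂q0 = rexp (-‖x‖ ^ 2 / (2 * (1 - rexp (-2 * t))))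
      * tiltInt q0 φ (linCoeff t • x) (quadCoeff t) := by
  rw [tiltInt, ← integral_const_mul]
  congr 1 with θ
  rw [weight_eq ht]
  ring

variable [IsProbabilityMeasure q0]

lemma integrable_weight {t : ℝ} (ht : 0 < t) (x : Vec d) : Integrable (weight t x) q0 := by
  refine (((ExpGrowth.const 1).integrable_tilt (linCoeff t • x) (quadCoeff_pos ht)).const_mul
    (rexp (-‖x‖ ^ 2 / (2 * (1 - rexp (-2 * t)))))).congr (ae_of_all _ fun θ => ?_)
  simp only [weight_eq ht, one_mul]

lemma lintegral_weight {t : ℝ} (ht : 0 < t) (x : Vec d) :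
    ∫⁻ θ, ENNReal.ofReal (weight t x θ) ∂q0
      = ENNReal.ofReal (rexp (-‖x‖ ^ 2 / (2 * (1 - rexp (-2 * t))))
        * tiltInt q0 (fun _ => 1) (linCoeff t • x) (quadCoeff t)) := by
  rw [← ofReal_integral_eq_lintegral_ofReal (integrable_weight ht x)
    (ae_of_all _ fun θ => (weight_pos t x θ).le), ← integral_mul_weight ht]
  simp

lemma integral_condMeasure {t : ℝ} (ht : 0 < t) (x : Vec d) (φ : Vec d → ℝ) :
    ∫ θ, φ θ ∂(condMeasure q0 t x) = tiltMean q0 φ (linCoeff t • x) (quadCoeff t) := by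
  have hpos := tiltInt_one_pos (q0 := q0) (linCoeff t • x) (quadCoeff_pos ht)
  rw [condMeasure, integral_smul_measure, integral_withDensity_eq_integral_toReal_smul
    (measurable_weight t x).ennreal_ofReal (ae_of_all _ fun _ => ENNReal.ofReal_lt_top)]
  simp_rw [ENNReal.toReal_ofReal (weight_pos t x _).le, smul_eq_mul]
  rw [integral_mul_weight ht, lintegral_weight ht, ENNReal.toReal_inv,
    ENNReal.toReal_ofReal (by positivity), tiltMean]
  field_simp

lemma ExpGrowth.integrable_condMeasure {φ : Vec d → ℝ} (hφ : ExpGrowth φ) {t : ℝ} (ht : 0 < t)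
    (x : Vec d) : Integrable φ (condMeasure q0 t x) := by
  have hpos := tiltInt_one_pos (q0 := q0) (linCoeff t • x) (quadCoeff_pos ht)
  refine Integrable.smul_measure ?_ ?_
  · rw [integrable_withDensity_iff_integrable_smul'
      (measurable_weight t x).ennreal_ofReal (ae_of_all _ fun _ => ENNReal.ofReal_lt_top)]
    refine ((hφ.integrable_tilt (linCoeff t • x) (quadCoeff_pos ht)).const_mul
      (rexp (-‖x‖ ^ 2 / (2 * (1 - rexp (-2 * t)))))).congr (ae_of_all _ fun θ => ?_)
    beta_reduce
    rw [ENNReal.toReal_ofReal (weight_pos t x _).le, weight_eq ht, smul_eq_mul]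
    ring
  · rw [lintegral_weight ht, ENNReal.inv_ne_top, ← pos_iff_ne_zero, ENNReal.ofReal_pos]
    positivity

lemma condMean_apply {t : ℝ} (ht : 0 < t) (x : Vec d) (i : Fin d) :
    condMean q0 t x i = tiltMean q0 (fun θ => θ i) (linCoeff t • x) (quadCoeff t) := by
  have hintegrable : Integrable (fun θ : Vec d => θ) (condMeasure q0 t x) :=
    (integrable_norm_iff (by fun_prop)).1 (ExpGrowth.norm.integrable_condMeasure ht x)
  rw [← integral_condMeasure ht, condMean]
  exact ((EuclideanSpace.proj (𝕜 := ℝ) i).integral_comp_comm hintegrable).symm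

lemma continuous_tiltInt_one {b : ℝ} (hb : 0 < b) (a : ℝ) :
    Continuous fun x : Vec d => tiltInt q0 (fun _ => 1) (a • x) b := by
  refine continuous_iff_continuousAt.2 fun x => ?_
  have h := (hasFDerivAt_tiltInt (q0 := q0) (ExpGrowth.const 1) (p := (a • x, b)) hb).2.continuousAt
  exact ContinuousAt.comp (f := fun x : Vec d => (a • x, b)) h (by fun_prop)

/-- Any continuous density of `q_t` is the Gaussian mixture density. -/
lemma exists_density_eq {u : ℝ} (hu : 0 < u) {r : Vec d → ℝ}
    (hr : forwardLaw q0 u = volume.withDensity fun x => ENNReal.ofReal (r x))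
    (hpos : ∀ x, 0 < r x) (hcont : Continuous r) :
    ∃ c : ℝ, 0 < c ∧ ∀ x, r x = c * (rexp (-‖x‖ ^ 2 / (2 * (1 - rexp (-2 * u))))
      * tiltInt q0 (fun _ => 1) (linCoeff u • x) (quadCoeff u)) := by
  obtain ⟨c, hc, hlaw⟩ := exists_forwardLaw_eq_withDensity q0 hu
  refine ⟨c, hc, ?_⟩
  have hcont' := continuous_tiltInt_one (q0 := q0) (quadCoeff_pos hu) (linCoeff u)
  have hpos' : ∀ x, 0 < c * (rexp (-‖x‖ ^ 2 / (2 * (1 - rexp (-2 * u))))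
      * tiltInt q0 (fun _ => 1) (linCoeff u • x) (quadCoeff u)) := fun x => by
    have := tiltInt_one_pos (q0 := q0) (linCoeff u • x) (quadCoeff_pos hu)
    positivity
  have hdens : ∀ x : Vec d, ∫⁻ θ, ENNReal.ofReal (c * weight u x θ) ∂q0
      = ENNReal.ofReal (c * (rexp (-‖x‖ ^ 2 / (2 * (1 - rexp (-2 * u))))
        * tiltInt q0 (fun _ => 1) (linCoeff u • x) (quadCoeff u))) := fun x => by
    simp_rw [ENNReal.ofReal_mul hc.le]
    rw [lintegral_const_mul _ (measurable_weight u x).ennreal_ofReal, lintegral_weight hu,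
      ENNReal.ofReal_mul (exp_pos _).le]
  simp_rw [hdens] at hlaw
  rw [hr, withDensity_eq_iff_of_sigmaFinite (by fun_prop) (by fun_prop)] at hlaw
  refine congrFun ((Continuous.ae_eq_iff_eq volume hcont (by fun_prop)).1 ?_)
  filter_upwards [hlaw] with x hx
  exact (ENNReal.ofReal_eq_ofReal_iff (hpos x).le (hpos' x).le).1 hx

end Bridge

section TiltAlgebra

variable {d : ℕ} {q0 : Measure (Vec d)} {z : Vec d} {b : ℝ}

lemma tiltMean_congr {φ ψ : Vec d → ℝ} (h : ∀ θ, φ θ = ψ θ) :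
    tiltMean q0 φ z b = tiltMean q0 ψ z b := by
  rw [funext h]

lemma tiltMean_const_mul (c : ℝ) (φ : Vec d → ℝ) :
    tiltMean q0 (fun θ => c * φ θ) z b = c * tiltMean q0 φ z b := by
  simp only [tiltMean, tiltInt, mul_assoc, integral_const_mul, mul_div_assoc]

variable [IsProbabilityMeasure q0]

lemma tiltMean_one (hb : 0 < b) : tiltMean q0 (fun _ => 1) z b = 1 :=
  div_self (tiltInt_one_pos z hb).ne'

lemma tiltMean_mul_sub_const (hb : 0 < b) {w p : Vec d → ℝ} (hw : ExpGrowth w) (hp : ExpGrowth p)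
    (P : ℝ) : tiltMean q0 (fun θ => w θ * (p θ - P)) z b
      = tiltMean q0 (fun θ => p θ * w θ) z b - P * tiltMean q0 w z b := by
  have h : tiltInt q0 (fun θ => w θ * (p θ - P)) z b
      = tiltInt q0 (fun θ => p θ * w θ) z b - P * tiltInt q0 w z b := by
    rw [tiltInt, tiltInt, tiltInt, ← integral_const_mul,
      ← integral_sub ((hp.mul hw).integrable_tilt z hb) ((hw.integrable_tilt z hb).const_mul P)]
    congr 1 with θ
    ring
  rw [tiltMean, h, tiltMean, tiltMean]
  ring

lemma tiltMean_mul_sub_const₂ (hb : 0 < b) {w p q : Vec d → ℝ} (hw : ExpGrowth w)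
    (hp : ExpGrowth p) (hq : ExpGrowth q) (P Q : ℝ) :
    tiltMean q0 (fun θ => w θ * (p θ - P) * (q θ - Q)) z b
      = tiltMean q0 (fun θ => p θ * (q θ * w θ)) z b - P * tiltMean q0 (fun θ => q θ * w θ) z b
        - Q * (tiltMean q0 (fun θ => p θ * w θ) z b - P * tiltMean q0 w z b) := by
  rw [tiltMean_mul_sub_const hb (hw.mul (hp.sub (.const P))) hq, tiltMean_mul_sub_const hb hw hp,
    ← tiltMean_mul_sub_const hb (hq.mul hw) hp]
  simp only [mul_assoc]

lemma tiltMean_mul_sub_const₃ (hb : 0 < b) {w p q r : Vec d → ℝ} (hw : ExpGrowth w)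
    (hp : ExpGrowth p) (hq : ExpGrowth q) (hr : ExpGrowth r) (P Q R : ℝ) :
    tiltMean q0 (fun θ => w θ * (p θ - P) * (q θ - Q) * (r θ - R)) z b
      = tiltMean q0 (fun θ => p θ * (q θ * (r θ * w θ))) z b
        - P * tiltMean q0 (fun θ => q θ * (r θ * w θ)) z b
        - Q * (tiltMean q0 (fun θ => p θ * (r θ * w θ)) z b
          - P * tiltMean q0 (fun θ => r θ * w θ) z b)
        - R * (tiltMean q0 (fun θ => p θ * (q θ * w θ)) z b
          - P * tiltMean q0 (fun θ => q θ * w θ) z b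
          - Q * (tiltMean q0 (fun θ => p θ * w θ) z b - P * tiltMean q0 w z b)) := by
  rw [tiltMean_mul_sub_const hb ((hw.mul (hp.sub (.const P))).mul (hq.sub (.const Q))) hr,
    tiltMean_mul_sub_const₂ hb hw hp hq, ← tiltMean_mul_sub_const₂ hb (hr.mul hw) hp hq]
  simp only [mul_assoc]

/-- The joint third cumulant of the coordinates `i`, `j`, `k` under the tilted measure. -/
def tiltCumulant (q0 : Measure (Vec d)) (i j k : Fin d) (z : Vec d) (b : ℝ) : ℝ :=
  tiltMean q0 (fun θ => θ i * (θ j * θ k)) z b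
    - tiltMean q0 (fun θ => θ j * θ k) z b * tiltMean q0 (fun θ => θ i) z b
    - (tiltMean q0 (fun θ => θ i * θ j) z b
        - tiltMean q0 (fun θ => θ i) z b * tiltMean q0 (fun θ => θ j) z b)
      * tiltMean q0 (fun θ => θ k) z b
    - tiltMean q0 (fun θ => θ j) z b
      * (tiltMean q0 (fun θ => θ i * θ k) z b
        - tiltMean q0 (fun θ => θ i) z b * tiltMean q0 (fun θ => θ k) z b)

lemma tiltMean_central_two (hb : 0 < b) {p q : Vec d → ℝ} (hp : ExpGrowth p) (hq : ExpGrowth q) :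
    tiltMean q0 (fun θ => (p θ - tiltMean q0 p z b) * (q θ - tiltMean q0 q z b)) z b
      = tiltMean q0 (fun θ => p θ * q θ) z b - tiltMean q0 p z b * tiltMean q0 q z b := by
  have h := tiltMean_mul_sub_const₂ (q0 := q0) (z := z) hb (.const 1) hp hq
    (tiltMean q0 p z b) (tiltMean q0 q z b)
  simp only [one_mul, mul_one, tiltMean_one hb] at h
  rw [h]
  ring

lemma tiltMean_central_three (hb : 0 < b) (i j k : Fin d) :
    tiltMean q0 (fun θ => (θ i - tiltMean q0 (fun θ => θ i) z b)
        * (θ j - tiltMean q0 (fun θ => θ j) z b) * (θ k - tiltMean q0 (fun θ => θ k) z b)) z b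
      = tiltCumulant q0 i j k z b := by
  have h := tiltMean_mul_sub_const₃ (q0 := q0) (z := z) hb (.const 1) (.coord i) (.coord j)
    (.coord k) (tiltMean q0 (fun θ => θ i) z b) (tiltMean q0 (fun θ => θ j) z b)
    (tiltMean q0 (fun θ => θ k) z b)
  simp only [one_mul, mul_one, tiltMean_one hb] at h
  rw [h, tiltCumulant]
  ring

lemma tiltMean_central_four (hb : 0 < b) (i j k : Fin d) {f : Vec d → ℝ} (hf : ExpGrowth f) :
    tiltMean q0 (fun θ => (θ i - tiltMean q0 (fun θ => θ i) z b)
        * (θ j - tiltMean q0 (fun θ => θ j) z b) * (θ k - tiltMean q0 (fun θ => θ k) z b)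
        * (f θ - tiltMean q0 f z b)) z b
      = tiltMean q0 (fun θ => θ i * (θ j * (θ k * f θ))) z b
        - tiltMean q0 (fun θ => θ i) z b * tiltMean q0 (fun θ => θ j * (θ k * f θ)) z b
        - tiltMean q0 (fun θ => θ j) z b * (tiltMean q0 (fun θ => θ i * (θ k * f θ)) z b
          - tiltMean q0 (fun θ => θ i) z b * tiltMean q0 (fun θ => θ k * f θ) z b)
        - tiltMean q0 (fun θ => θ k) z b * (tiltMean q0 (fun θ => θ i * (θ j * f θ)) z b
          - tiltMean q0 (fun θ => θ i) z b * tiltMean q0 (fun θ => θ j * f θ) z b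
          - tiltMean q0 (fun θ => θ j) z b * (tiltMean q0 (fun θ => θ i * f θ) z b
            - tiltMean q0 (fun θ => θ i) z b * tiltMean q0 f z b))
        - tiltMean q0 f z b * tiltCumulant q0 i j k z b := by
  rw [tiltMean_mul_sub_const hb ((((ExpGrowth.coord i).sub (.const _)).mul
    ((ExpGrowth.coord j).sub (.const _))).mul ((ExpGrowth.coord k).sub (.const _))) hf,
    tiltMean_central_three hb, ← tiltMean_mul_sub_const₃ hb hf (.coord i) (.coord j) (.coord k)]
  simp only [mul_assoc]

end TiltAlgebra

section SpatialDerivatives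

variable {d : ℕ} {q0 : Measure (Vec d)} [IsProbabilityMeasure q0] {b : ℝ}

lemma contDiff_pd {f : Vec d → ℝ} (hf : ContDiff ℝ (⊤ : ℕ∞) f) (i : Fin d) :
    ContDiff ℝ (⊤ : ℕ∞) (pd i f) :=
  (hf.fderiv_right (by simp)).clm_apply contDiff_const

lemma hasDerivAt_add_smul (y v : Vec d) (c : ℝ) :
    HasDerivAt (fun s : ℝ => c • (y + s • v)) (c • v) 0 := by
  have h := (((hasDerivAt_id (0 : ℝ)).smul_const v).const_add y).const_smul c
  rw [one_smul] at h
  exact h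

lemma pd_eq_of_hasDerivAt {f : Vec d → ℝ} (hf : ContDiff ℝ (⊤ : ℕ∞) f) {i : Fin d} {y : Vec d}
    {D : ℝ} (h : HasDerivAt (fun s : ℝ => f (y + s • EuclideanSpace.single i 1)) D 0) :
    pd i f y = D := by
  have hdiff : HasFDerivAt f (fderiv ℝ f y) (y + (0 : ℝ) • EuclideanSpace.single i (1 : ℝ)) := by
    rw [zero_smul, add_zero]
    exact (hf.differentiable (by simp) y).hasFDerivAt
  have hline := hasDerivAt_add_smul y (EuclideanSpace.single i (1 : ℝ)) 1
  simp only [one_smul] at hline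
  exact (hdiff.comp_hasDerivAt (0 : ℝ) hline).unique h

lemma exponent_single (a : ℝ) (i : Fin d) (θ : Vec d) :
    ⟪a • EuclideanSpace.single i (1 : ℝ), θ⟫ - 0 * ‖θ‖ ^ 2 = a * θ i := by
  simp [real_inner_smul_left, EuclideanSpace.inner_single_left]

lemma hasDerivAt_tiltMean_coord (hb : 0 < b) {φ : Vec d → ℝ} (hφ : ExpGrowth φ) (a : ℝ)
    (y : Vec d) (i : Fin d) :
    HasDerivAt (fun s : ℝ => tiltMean q0 φ (a • (y + s • EuclideanSpace.single i 1)) b)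
      (a * (tiltMean q0 (fun θ => θ i * φ θ) (a • y) b
        - tiltMean q0 (fun θ => θ i) (a • y) b * tiltMean q0 φ (a • y) b)) 0 := by
  have h := hasDerivAt_tiltMean (q0 := q0) hφ
    (hasDerivAt_add_smul y (EuclideanSpace.single i (1 : ℝ)) a) (hasDerivAt_const (0 : ℝ) b) hb
  simp only [exponent_single, zero_smul, add_zero] at h
  convert! h using 1
  have hg : tiltMean q0 (fun θ => φ θ * (a * θ i)) (a • y) b
      = a * tiltMean q0 (fun θ => θ i * φ θ) (a • y) b := by
    rw [← tiltMean_const_mul]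
    exact tiltMean_congr fun θ => by ring
  rw [hg, tiltMean_const_mul]
  ring

lemma hasDerivAt_log_tiltInt_coord (hb : 0 < b) (a : ℝ) (y : Vec d) (i : Fin d) :
    HasDerivAt (fun s : ℝ => log (tiltInt q0 (fun _ => 1)
        (a • (y + s • EuclideanSpace.single i 1)) b))
      (a * tiltMean q0 (fun θ => θ i) (a • y) b) 0 := by
  have h := (hasDerivAt_tiltInt (q0 := q0) (ExpGrowth.const 1)
    (hasDerivAt_add_smul y (EuclideanSpace.single i (1 : ℝ)) a)
    (hasDerivAt_const (0 : ℝ) b) hb).log (tiltInt_one_pos _ hb).ne'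
  simp only [exponent_single, zero_smul, add_zero, one_mul] at h
  convert! h using 1
  exact (tiltMean_const_mul a _).symm

/-- Third spatial derivatives of the log-density are rescaled third cumulants. -/
lemma pd_pd_pd_log_density {u : ℝ} (hu : 0 < u) {r : Vec d → ℝ}
    (hr : forwardLaw q0 u = volume.withDensity fun x => ENNReal.ofReal (r x))
    (hpos : ∀ x, 0 < r x) (hsmooth : ContDiff ℝ (⊤ : ℕ∞) r) (i j k : Fin d) (x : Vec d) :
    pd i (pd j (pd k fun y => log (r y))) x
      = linCoeff u ^ 3 * tiltCumulant q0 i j k (linCoeff u • x) (quadCoeff u) := by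
  have hb := quadCoeff_pos hu
  set a := linCoeff u with ha
  set b := quadCoeff u with hb'
  set v := 2 * (1 - rexp (-2 * u)) with hv
  obtain ⟨c, hc, hdens⟩ := exists_density_eq hu hr hpos hsmooth.continuous
  have hlog : ∀ y, log (r y)
      = log c + (-‖y‖ ^ 2 / v + log (tiltInt q0 (fun _ => 1) (a • y) b)) := fun y => by
    have := tiltInt_one_pos (q0 := q0) (a • y) hb
    rw [hdens, log_mul hc.ne' (by positivity), log_mul (exp_pos _).ne' this.ne', log_exp]
  have hsm : ContDiff ℝ (⊤ : ℕ∞) fun y => log (r y) := hsmooth.log fun y => (hpos y).ne'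
  have hfst : pd k (fun y => log (r y))
      = fun y => -(2 * y k) / v + a * tiltMean q0 (fun θ => θ k) (a • y) b := by
    ext y
    refine pd_eq_of_hasDerivAt hsm ?_
    simp only [hlog]
    refine HasDerivAt.const_add _ (.add ?_ (hasDerivAt_log_tiltInt_coord hb a y k))
    have hline := hasDerivAt_add_smul y (EuclideanSpace.single k (1 : ℝ)) 1
    simp only [one_smul] at hline
    convert! (hline.norm_sq.neg.div_const v) using 2
    simp [EuclideanSpace.inner_single_right]
  have hsnd : pd j (pd k fun y => log (r y))
      = fun y => -(2 * EuclideanSpace.single j (1 : ℝ) k) / v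
        + a * (a * (tiltMean q0 (fun θ => θ j * θ k) (a • y) b
          - tiltMean q0 (fun θ => θ j) (a • y) b * tiltMean q0 (fun θ => θ k) (a • y) b)) := by
    ext y
    refine pd_eq_of_hasDerivAt (contDiff_pd hsm k) ?_
    rw [hfst]
    refine HasDerivAt.add ?_ ((hasDerivAt_tiltMean_coord hb (.coord k) a y j).const_mul a)
    have hline : HasDerivAt (fun s : ℝ => (y + s • EuclideanSpace.single j (1 : ℝ)) k)
        (EuclideanSpace.single j (1 : ℝ) k) 0 := by
      simpa using ((hasDerivAt_id (0 : ℝ)).mul_const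
        (EuclideanSpace.single j (1 : ℝ) k)).const_add (y k)
    exact (hline.const_mul 2).neg.div_const v
  refine pd_eq_of_hasDerivAt (contDiff_pd (contDiff_pd hsm k) j) ?_
  rw [hsnd]
  have h := (((hasDerivAt_tiltMean_coord (q0 := q0) hb ((ExpGrowth.coord j).mul (.coord k)) a x
    i).sub ((hasDerivAt_tiltMean_coord (q0 := q0) hb (.coord j) a x i).mul
    (hasDerivAt_tiltMean_coord (q0 := q0) hb (.coord k) a x i))).const_mul a).const_mul a
  convert! h.const_add (-(2 * EuclideanSpace.single j (1 : ℝ) k) / v) using 1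
  simp only [zero_smul, add_zero, tiltCumulant]
  ring

end SpatialDerivatives

lemma sum_perm_fin_three (F : Fin 3 → Fin 3 → Fin 3 → ℝ) :
    ∑ p : Equiv.Perm (Fin 3), F (p 0) (p 1) (p 2)
      = F 0 1 2 + F 0 2 1 + F 1 0 2 + F 1 2 0 + F 2 0 1 + F 2 1 0 := by
  have huniv : (Finset.univ : Finset (Equiv.Perm (Fin 3)))
      = {1, Equiv.swap 1 2, Equiv.swap 0 1, Equiv.swap 0 1 * Equiv.swap 1 2,
        Equiv.swap 0 2 * Equiv.swap 1 2, Equiv.swap 0 2} := by decide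
  rw [huniv, Finset.sum_insert (by decide), Finset.sum_insert (by decide),
    Finset.sum_insert (by decide), Finset.sum_insert (by decide), Finset.sum_insert (by decide),
    Finset.sum_singleton]
  simp only [← add_assoc]
  rfl

/-- **Lemma (time derivative of the third derivative of the log-density).** If `q0` has finite
fourth moment then for `t > 0`, `x ∈ ℝ^d` and indices `i₁ i₂ i₃` (given by `idx : Fin 3 → Fin d`),
`∂_t ∇_x³ log q_t(x) = -3((λ_t³+λ_t⁵)/σ_t⁸) E_{t,x}[(θ-m)^{⊗3}] - (λ_t³/(2σ_t⁶)) Σ_π M_π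
  + (λ_t³/σ_t⁶) E_{t,x}[(θ-m)^{⊗3}(f₀ - E_{t,x} f₀)]`, stated entrywise. -/
theorem partial_t_third_deriv_log_density
    {d : ℕ} (hd : 1 ≤ d) (q0 : Measure (Vec d)) [IsProbabilityMeasure q0]
    (ρ : ℝ → Vec d → ℝ)
    (hρ : ∀ u, 0 < u → forwardLaw q0 u = volume.withDensity fun x => ENNReal.ofReal (ρ u x))
    (hρpos : ∀ u, 0 < u → ∀ x, 0 < ρ u x)
    (hρsmooth : ∀ u, 0 < u → ContDiff ℝ (⊤ : ℕ∞) (ρ u))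
    (hmom : Integrable (fun θ => ‖θ‖^4) q0)
    (t : ℝ) (ht : 0 < t) (x : Vec d) (idx : Fin 3 → Fin d) :
    HasDerivAt
      (fun u => pd (idx 0) (pd (idx 1) (pd (idx 2) (fun y => Real.log (ρ u y)))) x)
      (-(3 * (Real.exp (-t)^3 + Real.exp (-t)^5) / (1 - Real.exp (-2*t))^4)
          * ∫ θ, (θ (idx 0) - condMean q0 t x (idx 0)) * (θ (idx 1) - condMean q0 t x (idx 1))
              * (θ (idx 2) - condMean q0 t x (idx 2)) ∂(condMeasure q0 t x)
        - (Real.exp (-t)^3 / (2 * (1 - Real.exp (-2*t))^3))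
          * ∑ perm : Equiv.Perm (Fin 3),
              (∫ θ, (θ (idx (perm 0)) - condMean q0 t x (idx (perm 0)))
                  * (θ (idx (perm 1)) - condMean q0 t x (idx (perm 1))) ∂(condMeasure q0 t x))
              * (∫ θ, (θ (idx (perm 2)) - condMean q0 t x (idx (perm 2)))
                  * (f0 t x θ - ∫ θ', f0 t x θ' ∂(condMeasure q0 t x)) ∂(condMeasure q0 t x))
        + (Real.exp (-t)^3 / (1 - Real.exp (-2*t))^3)
          * ∫ θ, (θ (idx 0) - condMean q0 t x (idx 0)) * (θ (idx 1) - condMean q0 t x (idx 1))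
              * (θ (idx 2) - condMean q0 t x (idx 2))
              * (f0 t x θ - ∫ θ', f0 t x θ' ∂(condMeasure q0 t x))
              ∂(condMeasure q0 t x)) t := by
  have hb := quadCoeff_pos ht
  set z := linCoeff t • x with hz
  set b := quadCoeff t with hb'
  set i := idx 0
  set j := idx 1
  set k := idx 2
  have hf0 : ∀ θ, ⟪-((rexp (-t) + rexp (-t) ^ 3) / (1 - rexp (-2 * t)) ^ 2) • x, θ⟫
      - -(rexp (-t) ^ 2 / (1 - rexp (-2 * t)) ^ 2) * ‖θ‖ ^ 2 = f0 t x θ := fun θ => by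
    rw [real_inner_smul_left, f0]
    ring
  have hf : ExpGrowth (f0 t x) := funext hf0 ▸ ExpGrowth.exponent _ _
  have hmean : ∀ {φ : Vec d → ℝ}, ExpGrowth φ →
      HasDerivAt (fun u => tiltMean q0 φ (linCoeff u • x) (quadCoeff u))
        (tiltMean q0 (fun θ => φ θ * f0 t x θ) z b
          - tiltMean q0 φ z b * tiltMean q0 (f0 t x) z b) t := fun hφ => by
    simpa only [hf0] using hasDerivAt_tiltMean (q0 := q0) hφ
      ((hasDerivAt_linCoeff ht).smul_const x) (hasDerivAt_quadCoeff ht) hb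
  have hi := hmean (.coord i)
  have hj := hmean (.coord j)
  have hk := hmean (.coord k)
  have hcum := (((hmean ((ExpGrowth.coord i).mul ((ExpGrowth.coord j).mul (.coord k)))).sub
    ((hmean ((ExpGrowth.coord j).mul (.coord k))).mul hi)).sub
    (((hmean ((ExpGrowth.coord i).mul (.coord j))).sub (hi.mul hj)).mul hk)).sub
    (hj.mul ((hmean ((ExpGrowth.coord i).mul (.coord k))).sub (hi.mul hk)))
  have hmain := ((hasDerivAt_linCoeff ht).pow 3).mul hcum
  have hpd : (fun u => pd i (pd j (pd k fun y => log (ρ u y))) x) =ᶠ[nhds t]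
      fun u => linCoeff u ^ 3 * tiltCumulant q0 i j k (linCoeff u • x) (quadCoeff u) := by
    filter_upwards [lt_mem_nhds ht] with u hu
    exact pd_pd_pd_log_density hu (hρ u hu) (hρpos u hu) (hρsmooth u hu) i j k x
  refine (HasDerivAt.congr_of_eventuallyEq ?_ hpd)
  convert! hmain using 1
  have hcomm : ∀ l m : Fin d, tiltMean q0 (fun θ => θ l * θ m) z b
      = tiltMean q0 (fun θ => θ m * θ l) z b := fun l m => tiltMean_congr fun θ => mul_comm _ _
  simp only [integral_condMeasure ht, condMean_apply ht, ← hz, ← hb']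
  rw [sum_perm_fin_three fun l m n =>
    tiltMean q0 (fun θ => (θ (idx l) - tiltMean q0 (fun θ => θ (idx l)) z b)
      * (θ (idx m) - tiltMean q0 (fun θ => θ (idx m)) z b)) z b
    * tiltMean q0 (fun θ => (θ (idx n) - tiltMean q0 (fun θ => θ (idx n)) z b)
      * (f0 t x θ - tiltMean q0 (f0 t x) z b)) z b]
  simp only [tiltMean_central_two hb (.coord _) (.coord _), tiltMean_central_two hb (.coord _) hf,
    tiltMean_central_three hb, tiltMean_central_four hb _ _ _ hf]
  change _ = (3 : ℕ) * linCoeff t ^ 2 * _ * tiltCumulant q0 i j k z b + linCoeff t ^ 3 * _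
  rw [hcomm j i, hcomm k i, hcomm k j]
  simp only [Pi.sub_apply, Pi.mul_apply, ← hz, ← hb', tiltCumulant, mul_assoc,
    show idx 0 = i from rfl, show idx 1 = j from rfl, show idx 2 = k from rfl]
  simp only [linCoeff]
  generalize 1 - rexp (-2 * t) = v
  generalize rexp (-t) = l
  push_cast
  ring

end
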